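/- arXiv:2104.09466 — 3 statements merged into one kernel-verified Lean document; each statement's English description precedes it below -/
import Mathlib

section
/- Let G be a group and let α : G → Gᵃᵇ denote the abelianization homomorphism. The map f : G × G → Gᵃᵇ defined by f(a,b) = α(a) · α(b)⁻¹ is a group homomorphism, it is surjective, and its kernel equals the normal closure in G × G of the diagonal subgroup {(g,g) : g ∈ G}. -/
/-- A normal subgroup of `G × G` containing the diagonal contains `[G, G] × 1`. -/
theorem commutator_le_comap_inl_of_diagonal_le {G : Type*} [Group G] (N : Subgroup (G × G))
    [N.Normal] (hN : ∀ g : G, (g, g) ∈ N) :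
    commutator G ≤ N.comap (MonoidHom.inl G G) := by
  rw [commutator_def, Subgroup.commutator_le]
  intro g _ h _
  have key := N.mul_mem (‹N.Normal›.conj_mem (h, h) (hN h) (g, 1)) (N.inv_mem (hN h))
  simpa [commutatorElement_def] using key

/-- Let `G` be a group and `α : G → Gᵃᵇ` the abelianization homomorphism. The map
`f : G × G → Gᵃᵇ`, `f (a, b) = α a * (α b)⁻¹`, is a group homomorphism, it is
surjective, and its kernel is the normal closure in `G × G` of the diagonal
subgroup `{(g, g) : g ∈ G}`. -/
theorem abelianization_of_pushout_diagonal (G : Type*) [Group G] :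
    ∃ f : G × G →* Abelianization G,
      (∀ a b : G, f (a, b) = Abelianization.of a * (Abelianization.of b)⁻¹) ∧
      Function.Surjective f ∧
      f.ker = Subgroup.normalClosure {x : G × G | ∃ g : G, x = (g, g)} := by
  let f : G × G →* Abelianization G :=
    Abelianization.of.comp (MonoidHom.fst G G) / Abelianization.of.comp (MonoidHom.snd G G)
  have hf (a b : G) : f (a, b) = Abelianization.of a * (Abelianization.of b)⁻¹ :=
    div_eq_mul_inv _ _
  refine ⟨f, hf, fun y => ?_, le_antisymm ?_ (Subgroup.normalClosure_le_normal ?_)⟩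
  · obtain ⟨a, rfl⟩ := QuotientGroup.mk_surjective y
    exact ⟨(a, 1), by rw [hf, map_one, inv_one, mul_one]; rfl⟩
  · rintro ⟨a, b⟩ hab
    have hdiag (g : G) : (g, g) ∈ Subgroup.normalClosure {x : G × G | ∃ g : G, x = (g, g)} :=
      Subgroup.subset_normalClosure ⟨g, rfl⟩
    have hcomm : a * b⁻¹ ∈ commutator G := by
      rw [← Abelianization.ker_of, MonoidHom.mem_ker, map_mul, map_inv, ← hf]
      exact hab
    have key := Subgroup.mul_mem _
      (Subgroup.mem_comap.1 (commutator_le_comap_inl_of_diagonal_le _ hdiag hcomm)) (hdiag b)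
    simpa using key
  · rintro _ ⟨g, rfl⟩
    rw [SetLike.mem_coe, MonoidHom.mem_ker, hf, mul_inv_cancel]
end

section
/- Let r ≥ 0, let Λ be the exterior algebra over ℤ of the free module ℤ^r = (Fin r → ℤ), and let j : Λ → Λ be the ℤ-algebra homomorphism induced by the linear map -id on ℤ^r. For every n ≥ 2 such that n is odd or 2n > r, and for every homogeneous element c of Λ of degree n, one has c * j(c) = 0. -/
/-- A vector commutes up to the sign `(-1) ^ n` with an element of degree `n`. -/
lemma ExteriorAlgebra.ι_mul_eq_neg_one_pow_smul {R M : Type*} [CommRing R] [AddCommGroup M]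
    [Module R M] (v : M) {n : ℕ} {y : ExteriorAlgebra R M}
    (hy : y ∈ LinearMap.range (ExteriorAlgebra.ι R (M := M)) ^ n) :
    ExteriorAlgebra.ι R v * y = (-1 : R) ^ n • (y * ExteriorAlgebra.ι R v) := by
  induction hy using Submodule.pow_induction_on_left' with
  | algebraMap r => simp [Algebra.commutes]
  | add x y i hx hy ihx ihy => rw [mul_add, ihx, ihy, add_mul, smul_add]
  | mem_mul m hm i x hx ih =>
    obtain ⟨w, rfl⟩ := hm
    have h : ExteriorAlgebra.ι R v * ExteriorAlgebra.ι R w =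
        -(ExteriorAlgebra.ι R w * ExteriorAlgebra.ι R v) :=
      eq_neg_of_add_eq_zero_left (ExteriorAlgebra.ι_add_mul_swap v w)
    rw [← mul_assoc, h, neg_mul, mul_assoc, ih, mul_smul_comm, pow_succ, mul_neg_one, neg_smul,
      mul_assoc]

/-- Graded commutativity of the exterior algebra. -/
lemma ExteriorAlgebra.mul_eq_neg_one_pow_smul_mul {R M : Type*} [CommRing R] [AddCommGroup M]
    [Module R M] {m n : ℕ} {x y : ExteriorAlgebra R M}
    (hx : x ∈ LinearMap.range (ExteriorAlgebra.ι R (M := M)) ^ m)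
    (hy : y ∈ LinearMap.range (ExteriorAlgebra.ι R (M := M)) ^ n) :
    x * y = (-1 : R) ^ (m * n) • (y * x) := by
  induction hx using Submodule.pow_induction_on_left' with
  | algebraMap r => simp [Algebra.commutes]
  | add x z i hx hz ihx ihz => rw [add_mul, ihx, ihz, mul_add, smul_add]
  | mem_mul w hw i x hx ih =>
    obtain ⟨v, rfl⟩ := hw
    rw [mul_assoc, ih, mul_smul_comm, ← mul_assoc, ExteriorAlgebra.ι_mul_eq_neg_one_pow_smul v hy,
      smul_mul_assoc, smul_smul, ← pow_add, mul_assoc, Nat.succ_mul]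

/-- An algebra endomorphism extending `-id` acts on degree `n` as multiplication by `(-1) ^ n`. -/
lemma ExteriorAlgebra.algHom_apply_eq_neg_one_pow_smul {R M : Type*} [CommRing R] [AddCommGroup M]
    [Module R M] (j : ExteriorAlgebra R M →ₐ[R] ExteriorAlgebra R M)
    (hj : ∀ v, j (ExteriorAlgebra.ι R v) = ExteriorAlgebra.ι R (-v)) {n : ℕ}
    {x : ExteriorAlgebra R M} (hx : x ∈ LinearMap.range (ExteriorAlgebra.ι R (M := M)) ^ n) :
    j x = (-1 : R) ^ n • x := by
  induction hx using Submodule.pow_induction_on_left' with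
  | algebraMap r => simp
  | add x y i hx hy ihx ihy => rw [map_add, ihx, ihy, smul_add]
  | mem_mul w hw i x hx ih =>
    obtain ⟨v, rfl⟩ := hw
    rw [map_mul, hj, ih, map_neg, mul_smul_comm, pow_succ, mul_neg_one, neg_smul, neg_mul, smul_neg]

/-- Exterior powers above the rank of a finite free module vanish. -/
lemma exteriorPower.eq_bot_of_finrank_lt {R M : Type*} [CommRing R] [IsDomain R]
    [AddCommGroup M] [Module R M] [Module.Free R M] [Module.Finite R M] {n : ℕ}
    (h : Module.finrank R M < n) : ⋀[R]^n M = ⊥ := by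
  rw [← Submodule.subsingleton_iff_eq_bot, ← Module.finrank_eq_zero_iff_of_free R,
    exteriorPower.finrank_eq, Nat.choose_eq_zero_of_lt h]


/-- Let `Λ` be the exterior algebra over `ℤ` of `ℤ^r = (Fin r → ℤ)` and `j` the
algebra endomorphism of `Λ` induced by the linear map `-id` on `ℤ^r`. For every
`n ≥ 2` with `n` odd or `2n > r`, and every homogeneous element `c` of degree `n`
(i.e. `c` lies in the `n`-th power of the range of the canonical inclusion `ι`),
one has `c * j c = 0`. -/
theorem exteriorAlgebra_mul_inversion_eq_zero (r : ℕ)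
    (j : ExteriorAlgebra ℤ (Fin r → ℤ) →ₐ[ℤ] ExteriorAlgebra ℤ (Fin r → ℤ))
    (hj : ∀ v : Fin r → ℤ, j (ExteriorAlgebra.ι ℤ v) = ExteriorAlgebra.ι ℤ (-v))
    (n : ℕ) (hn : 2 ≤ n) (hcond : Odd n ∨ r < 2 * n)
    (c : ExteriorAlgebra ℤ (Fin r → ℤ))
    (hc : c ∈ (LinearMap.range (ExteriorAlgebra.ι ℤ (M := Fin r → ℤ)) ^ n :
      Submodule ℤ (ExteriorAlgebra ℤ (Fin r → ℤ)))) :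
    c * j c = 0 := by
  suffices h : c * c = 0 by
    rw [ExteriorAlgebra.algHom_apply_eq_neg_one_pow_smul j hj hc, mul_smul_comm, h, smul_zero]
  rcases hcond with hodd | hlt
  · have h := ExteriorAlgebra.mul_eq_neg_one_pow_smul_mul hc hc
    rw [(hodd.mul hodd).neg_one_pow, neg_one_smul] at h
    have : Module.Free ℤ (ExteriorAlgebra ℤ (Fin r → ℤ)) :=
      .of_basis (Pi.basisFun ℤ (Fin r)).ExteriorAlgebra
    have : Module.IsTorsionFree ℤ (ExteriorAlgebra ℤ (Fin r → ℤ)) := inferInstance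
    have h2 : (2 : ℤ) • (c * c) = 0 := by
      rw [two_smul]
      exact eq_neg_iff_add_eq_zero.mp h
    exact (smul_eq_zero.mp h2).resolve_left two_ne_zero
  · have hmem : c * c ∈ ⋀[ℤ]^(n + n) (Fin r → ℤ) := by
      rw [ExteriorAlgebra.exteriorPower, pow_add]
      exact Submodule.mul_mem_mul hc hc
    rwa [exteriorPower.eq_bot_of_finrank_lt (by simp; omega), Submodule.mem_bot] at hmem
end

section
/- Let r ≥ 0 and let Λ be the exterior algebra over ℤ of the free module ℤ^r = (Fin r → ℤ). If c is a homogeneous element of Λ of positive even degree, then there exists e ∈ Λ such that c * c = 2·e. -/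
namespace ExteriorAlgebra

variable {R M : Type*} [CommRing R] [AddCommGroup M] [Module R M]

theorem ι_mul_ι_mem_center (x y : M) :
    ι R x * ι R y ∈ Subalgebra.center R (ExteriorAlgebra R M) := by
  have swap (u v : M) : ι R u * ι R v = -(ι R v * ι R u) :=
    eq_neg_of_add_eq_zero_left (ι_add_mul_swap u v)
  rw [Subalgebra.mem_center_iff]
  intro d
  induction d using ExteriorAlgebra.induction with
  | algebraMap r => exact Algebra.commutes r _
  | ι z =>
    rw [← mul_assoc, swap z x, neg_mul, mul_assoc, swap z y, mul_neg, neg_neg, mul_assoc]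
  | mul a b ha hb => rw [mul_assoc, hb, ← mul_assoc, ha, mul_assoc]
  | add a b ha hb => rw [add_mul, mul_add, ha, hb]

theorem exteriorPower_le_center_of_even {n : ℕ} (hn : Even n) :
    ⋀[R]^n M ≤ Subalgebra.toSubmodule (Subalgebra.center R (ExteriorAlgebra R M)) := by
  obtain ⟨k, rfl⟩ := hn
  have h2 : LinearMap.range (ι R (M := M)) ^ 2 ≤
      Subalgebra.toSubmodule (Subalgebra.center R (ExteriorAlgebra R M)) := by
    rw [pow_two, Submodule.mul_le]
    rintro _ ⟨x, rfl⟩ _ ⟨y, rfl⟩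
    exact ι_mul_ι_mem_center x y
  rw [exteriorPower, ← two_mul, pow_mul]
  intro c hc
  induction hc using Submodule.pow_induction_on_left' with
  | algebraMap r => exact Subalgebra.algebraMap_mem _ r
  | add x y i hx hy ihx ihy => exact add_mem ihx ihy
  | mem_mul m hm i x hx ih => exact Subalgebra.mul_mem _ (h2 hm) ih

theorem ιMulti_mul_self {n : ℕ} (hn : 0 < n) (v : Fin n → M) :
    ιMulti R n v * ιMulti R n v = 0 := by
  rw [ιMulti_mul_ιMulti]
  refine ιMulti_eq_zero_of_not_inj fun h ↦ ?_
  have := @h (Fin.castAdd n ⟨0, hn⟩) (Fin.natAdd n ⟨0, hn⟩)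
    (by rw [Fin.append_left, Fin.append_right])
  simp only [Fin.ext_iff, Fin.val_castAdd, Fin.val_natAdd] at this
  omega

theorem two_dvd_mul_self_of_even {n : ℕ} (hn : Even n) (hpos : 0 < n)
    {c : ExteriorAlgebra R M} (hc : c ∈ ⋀[R]^n M) : 2 ∣ c * c := by
  rw [← ιMulti_span_fixedDegree] at hc
  induction hc using Submodule.span_induction with
  | mem x hx =>
    obtain ⟨v, rfl⟩ := hx
    rw [ιMulti_mul_self hpos]
    exact dvd_zero _
  | zero => simp
  | add x y hx hy ihx ihy =>
    rw [ιMulti_span_fixedDegree] at hx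
    have hcomm : y * x = x * y :=
      (Subalgebra.mem_center_iff (R := R)).1 (exteriorPower_le_center_of_even hn hx) y
    have h : (x + y) * (x + y) = x * x + y * y + 2 * (x * y) := by
      rw [add_mul, mul_add, mul_add, hcomm, two_mul]
      abel
    rw [h]
    exact dvd_add (dvd_add ihx ihy) (dvd_mul_right _ _)
  | smul a x hx ih =>
    obtain ⟨e, he⟩ := ih
    exact ⟨a • a • e, by rw [smul_mul_smul_comm, he, mul_smul_comm, mul_smul_comm, mul_smul]⟩

end ExteriorAlgebra


/-- In the exterior algebra over `ℤ` of `ℤ^r = (Fin r → ℤ)`, the square of a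
homogeneous element of positive even degree is divisible by `2`. -/
theorem exteriorAlgebra_sq_divisible_by_two_of_even_degree (r n : ℕ)
    (hn : Even n) (hpos : 0 < n)
    (c : ExteriorAlgebra ℤ (Fin r → ℤ))
    (hc : c ∈ (LinearMap.range (ExteriorAlgebra.ι ℤ (M := Fin r → ℤ)) ^ n :
      Submodule ℤ (ExteriorAlgebra ℤ (Fin r → ℤ)))) :
    ∃ e : ExteriorAlgebra ℤ (Fin r → ℤ), c * c = 2 * e := by
  exact ExteriorAlgebra.two_dvd_mul_self_of_even hn hpos hc
end
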